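/- Let M and N be C*-ternary rings with Zettl decompositions: M = M₊ ⊕ M₋ where M₊ and M₋ are closed subspaces, stable under the triple product, such that there exist complex Hilbert spaces, TROs V₊ ⊆ B(H₊,K₊) and V₋ ⊆ B(H₋,K₋), and isometric linear bijections ψ₊ : M₊ → V₊ with ψ₊([x y z]) = ψ₊(x)ψ₊(y)*ψ₊(z) and ψ₋ : M₋ → V₋ with ψ₋([x y z]) = −ψ₋(x)ψ₋(y)*ψ₋(z); and analogously N = N₊ ⊕ N₋. If φ : M → N is a surjective homomorphism of C*-ternary rings, then φ(M₊) = N₊ and φ(M₋) = N₋. -/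

import Mathlib

/-- A C*-ternary ring: a complex Banach space `Z` (completeness is imposed where needed)
with a triple product `[x y z] = t x y z`, linear in the outer variables, conjugate-linear in
the middle variable, associative in the sense that
`[[v w x] y z] = [v [y x w] z] = [v w [x y z]]`, and satisfying
`‖[x y z]‖ ≤ ‖x‖‖y‖‖z‖` and `‖[x x x]‖ = ‖x‖³`. -/
structure CstarTernary (Z : Type*) [NormedAddCommGroup Z] [NormedSpace ℂ Z] where
  t : Z → Z → Z → Z
  add_left : ∀ x w y z, t (x + w) y z = t x y z + t w y z
  smul_left : ∀ (c : ℂ) (x y z), t (c • x) y z = c • t x y z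
  add_mid : ∀ x y w z, t x (y + w) z = t x y z + t x w z
  smul_mid : ∀ (c : ℂ) (x y z), t x (c • y) z = (starRingEnd ℂ) c • t x y z
  add_right : ∀ x y z w, t x y (z + w) = t x y z + t x y w
  smul_right : ∀ (c : ℂ) (x y z), t x y (c • z) = c • t x y z
  assoc₁ : ∀ v w x y z, t (t v w x) y z = t v (t y x w) z
  assoc₂ : ∀ v w x y z, t (t v w x) y z = t v w (t x y z)
  norm_le : ∀ x y z, ‖t x y z‖ ≤ ‖x‖ * ‖y‖ * ‖z‖
  norm_cube : ∀ x, ‖t x x x‖ = ‖x‖ ^ 3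

/-- `P` is a positive (`ε = 1`) or negative (`ε = -1`) Zettl part of the C*-ternary ring:
a closed subspace, stable under the triple product, carrying an isometric linear bijection
`ψ` onto a TRO `V ⊆ B(H,K)` with `ψ [x y z] = ε • ψ(x) ψ(y)* ψ(z)` (the TRO being the
range of `ψ`). -/
def IsZettlPart {Z : Type*} [NormedAddCommGroup Z] [NormedSpace ℂ Z]
    (S : CstarTernary Z) (P : Submodule ℂ Z) (ε : ℝ) : Prop :=
  IsClosed (P : Set Z) ∧
  (∀ x y z : Z, x ∈ P → y ∈ P → z ∈ P → S.t x y z ∈ P) ∧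
  ∃ (H : Type*) (K : Type*)
    (_ : NormedAddCommGroup H) (_ : InnerProductSpace ℂ H) (_ : CompleteSpace H)
    (_ : NormedAddCommGroup K) (_ : InnerProductSpace ℂ K) (_ : CompleteSpace K)
    (ψ : P →ₗ[ℂ] (H →L[ℂ] K)),
      (∀ x : P, ‖ψ x‖ = ‖(x : Z)‖) ∧
      (∀ x y z w : P, (w : Z) = S.t (x : Z) (y : Z) (z : Z) →
        ψ w = ε • ((ψ x).comp ((ContinuousLinearMap.adjoint (ψ y)).comp (ψ z))))

section CStarAlgebraPositivity

variable {A : Type*} [CStarAlgebra A] [PartialOrder A] [StarOrderedRing A]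

/-- A self-adjoint element `a` with `l + a` right invertible for all real `l > 0` is positive. -/
theorem nonneg_of_forall_add_mul_eq {a : A} (ha : IsSelfAdjoint a)
    (h : ∀ l : ℝ, 0 < l → ∃ b : A, ((l : ℂ) • (1 : A) + a) * b = (l : ℂ) • (1 : A)) :
    0 ≤ a := by
  rw [StarOrderedRing.nonneg_iff_spectrum_nonneg (R := ℝ) a ha]
  intro x hx
  by_contra! hneg
  obtain ⟨b, hb⟩ := h (-x) (neg_pos.2 hneg)
  apply hx
  rw [spectrum.mem_resolventSet_iff]
  have hx0 : ((-x : ℝ) : ℂ) ≠ 0 := by exact_mod_cast (neg_pos.2 hneg).ne'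
  have hsa : star (((-x : ℝ) : ℂ) • (1 : A) + a) = ((-x : ℝ) : ℂ) • (1 : A) + a := by
    rw [star_add, ha.star_eq, star_smul, star_one, Complex.star_def, Complex.conj_ofReal]
  have hright : (((-x : ℝ) : ℂ) • (1 : A) + a) * (((-x : ℝ) : ℂ)⁻¹ • b) = 1 := by
    rw [mul_smul_comm, hb, smul_smul, inv_mul_cancel₀ hx0, one_smul]
  have hleft : star (((-x : ℝ) : ℂ)⁻¹ • b) * (((-x : ℝ) : ℂ) • (1 : A) + a) = 1 := by
    have := congrArg star hright
    rwa [star_mul, hsa, star_one] at this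
  have hu : IsUnit (((-x : ℝ) : ℂ) • (1 : A) + a) :=
    isUnit_iff_exists_and_exists.2 ⟨⟨_, hright⟩, ⟨_, hleft⟩⟩
  have heq : algebraMap ℝ A x - a = -(((-x : ℝ) : ℂ) • (1 : A) + a) := by
    rw [Algebra.algebraMap_eq_smul_one, Complex.coe_smul]
    module
  rw [heq]
  exact hu.neg

/-- If `a` is positive then `l + a` is invertible for all real `l > 0`. -/
theorem isUnit_smul_one_add_of_nonneg {a : A} (ha : 0 ≤ a) {l : ℝ} (hl : 0 < l) :
    IsUnit ((l : ℂ) • (1 : A) + a) := by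
  by_contra hu
  have hmem : -l ∈ spectrum ℝ a := by
    intro hu'
    rw [spectrum.mem_resolventSet_iff] at hu'
    apply hu
    have heq : algebraMap ℝ A (-l) - a = -((l : ℂ) • (1 : A) + a) := by
      rw [Algebra.algebraMap_eq_smul_one, Complex.coe_smul]
      module
    rw [heq] at hu'
    simpa using hu'.neg
  have := (StarOrderedRing.nonneg_iff_spectrum_nonneg (R := ℝ) a ha.isSelfAdjoint).1 ha _ hmem
  linarith

end CStarAlgebraPositivity

namespace CstarTernary

variable {Z : Type*} [NormedAddCommGroup Z] [NormedSpace ℂ Z]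

section Basic

variable (S : CstarTernary Z)

theorem t_sub_right (x y z w : Z) : S.t x y (z - w) = S.t x y z - S.t x y w := by
  have h := S.add_right x y (z - w) w
  rw [sub_add_cancel] at h
  rw [h, add_sub_cancel_right]

theorem eq_zero_of_cube_eq_zero {x : Z} (h : S.t x x x = 0) : x = 0 := by
  have := S.norm_cube x
  rw [h, norm_zero] at this
  exact norm_eq_zero.1 (pow_eq_zero_iff (three_ne_zero) |>.1 this.symm)

/-- The C*-ternary ring with the outer variables of the product exchanged. -/
@[simps]
def flip : CstarTernary Z where
  t x y z := S.t z y x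
  add_left x w y z := S.add_right z y x w
  smul_left c x y z := S.smul_right c z y x
  add_mid x y w z := S.add_mid z y w x
  smul_mid c x y z := S.smul_mid c z y x
  add_right x y z w := S.add_left z w y x
  smul_right c x y z := S.smul_left c z y x
  assoc₁ v w x y z := by rw [← S.assoc₂, S.assoc₁]
  assoc₂ v w x y z := by rw [← S.assoc₂]
  norm_le x y z := by
    calc ‖S.t z y x‖ ≤ ‖z‖ * ‖y‖ * ‖x‖ := S.norm_le z y x
      _ = ‖x‖ * ‖y‖ * ‖z‖ := by ring
  norm_cube x := S.norm_cube x

/-- `B` is an adjoint of the operator `A` with respect to the triple product. -/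
def IsAdjoint (A B : Z →L[ℂ] Z) : Prop :=
  (∀ x y z, S.t x (A y) z = S.t x y (B z)) ∧ ∀ x y z, S.t x (B y) z = S.t x y (A z)

end Basic

section IsAdjoint

variable {S : CstarTernary Z} {A B C D : Z →L[ℂ] Z}

theorem IsAdjoint.symm (h : S.IsAdjoint A B) : S.IsAdjoint B A := ⟨h.2, h.1⟩

theorem IsAdjoint.add (h : S.IsAdjoint A B) (h' : S.IsAdjoint C D) :
    S.IsAdjoint (A + C) (B + D) := by
  constructor <;> intro x y z <;>
    simp only [add_apply, S.add_mid, S.add_right, h.1, h.2, h'.1, h'.2]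

theorem IsAdjoint.mul (h : S.IsAdjoint A B) (h' : S.IsAdjoint C D) :
    S.IsAdjoint (A * C) (D * B) := by
  constructor <;> intro x y z <;>
    simp only [mul_apply_eq_comp, h.1, h.2, h'.1, h'.2]

theorem IsAdjoint.smul (h : S.IsAdjoint A B) (c : ℂ) :
    S.IsAdjoint (c • A) ((starRingEnd ℂ) c • B) := by
  constructor <;> intro x y z <;>
    simp only [smul_apply, S.smul_mid, S.smul_right, h.1, h.2,
      Complex.conj_conj]

theorem isAdjoint_one (S : CstarTernary Z) : S.IsAdjoint 1 1 :=
  ⟨fun _ _ _ ↦ rfl, fun _ _ _ ↦ rfl⟩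

theorem IsAdjoint.norm_apply_sq_le (h : S.IsAdjoint A B) (z : Z) :
    ‖A z‖ ^ 2 ≤ ‖B * A‖ * ‖z‖ ^ 2 := by
  rcases eq_or_ne (A z) 0 with h0 | h0
  · rw [h0, norm_zero, zero_pow two_ne_zero]
    positivity
  have h1 : ‖A z‖ ^ 3 ≤ ‖A z‖ * ‖z‖ * (‖B * A‖ * ‖z‖) := by
    rw [← S.norm_cube, h.1]
    refine (S.norm_le _ _ _).trans ?_
    gcongr
    exact (B * A).le_opNorm z
  have hpos : 0 < ‖A z‖ := norm_pos_iff.2 h0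
  refine le_of_mul_le_mul_left ?_ hpos
  calc ‖A z‖ * ‖A z‖ ^ 2 = ‖A z‖ ^ 3 := by ring
    _ ≤ _ := h1
    _ = _ := by ring

theorem IsAdjoint.norm_mul_self_le (h : S.IsAdjoint A B) : ‖A‖ * ‖A‖ ≤ ‖B * A‖ := by
  have : ‖A‖ ≤ √‖B * A‖ := by
    refine A.opNorm_le_bound (Real.sqrt_nonneg _) fun z ↦ ?_
    refine le_of_sq_le_sq ?_ (by positivity)
    rw [mul_pow, Real.sq_sqrt (norm_nonneg _)]
    exact h.norm_apply_sq_le z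
  calc ‖A‖ * ‖A‖ ≤ √‖B * A‖ * √‖B * A‖ := by gcongr
    _ = _ := Real.mul_self_sqrt (norm_nonneg _)

theorem IsAdjoint.norm_le (h : S.IsAdjoint A B) : ‖A‖ ≤ ‖B‖ := by
  rcases (norm_nonneg A).eq_or_lt with h0 | h0
  · rw [← h0]
    exact norm_nonneg _
  · exact le_of_mul_le_mul_right (h.norm_mul_self_le.trans (norm_mul_le _ _)) h0

theorem IsAdjoint.sub (h : S.IsAdjoint A B) (h' : S.IsAdjoint C D) :
    S.IsAdjoint (A - C) (B - D) := by
  simpa [sub_eq_add_neg] using h.add (h'.smul (-1))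

theorem IsAdjoint.unique (h : S.IsAdjoint A B) (h' : S.IsAdjoint A C) : B = C := by
  have := (h.sub h').symm.norm_le
  rw [sub_self, norm_zero] at this
  exact sub_eq_zero.1 (norm_le_zero_iff.1 this)

end IsAdjoint

theorem continuous_t_right (S : CstarTernary Z) (x y : Z) : Continuous (S.t x y) :=
  AddMonoidHomClass.continuous_of_bound
    (AddMonoidHom.mk' (S.t x y) (S.add_right x y)) (‖x‖ * ‖y‖) (S.norm_le x y)

theorem continuous_t_mid (S : CstarTernary Z) (x z : Z) : Continuous (fun y ↦ S.t x y z) :=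
  AddMonoidHomClass.continuous_of_bound
    (AddMonoidHom.mk' (fun y ↦ S.t x y z) (fun y w ↦ S.add_mid x y w z)) (‖x‖ * ‖z‖)
    fun y ↦ (S.norm_le x y z).trans_eq (by ring)

/-- The algebra of adjointable operators of a C*-ternary ring. -/
def adjointable (S : CstarTernary Z) : Subalgebra ℂ (Z →L[ℂ] Z) where
  carrier := {A | ∃ B, S.IsAdjoint A B}
  mul_mem' := fun ⟨_, h⟩ ⟨_, h'⟩ ↦ ⟨_, h.mul h'⟩
  add_mem' := fun ⟨_, h⟩ ⟨_, h'⟩ ↦ ⟨_, h.add h'⟩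
  algebraMap_mem' c := by
    rw [Algebra.algebraMap_eq_smul_one]
    exact ⟨_, S.isAdjoint_one.smul c⟩

theorem isClosed_adjointable [CompleteSpace Z] (S : CstarTernary Z) :
    IsClosed (S.adjointable : Set (Z →L[ℂ] Z)) := by
  refine isClosed_of_closure_subset fun A hA ↦ ?_
  obtain ⟨u, hu, hlim⟩ := mem_closure_iff_seq_limit.1 hA
  choose v hv using hu
  have hcauchy : CauchySeq v := by
    have hc := hlim.cauchySeq
    rw [Metric.cauchySeq_iff] at hc ⊢
    intro e he
    obtain ⟨n, hn⟩ := hc e he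
    refine ⟨n, fun i hi j hj ↦ lt_of_le_of_lt ?_ (hn i hi j hj)⟩
    rw [dist_eq_norm, dist_eq_norm]
    exact ((hv i).sub (hv j)).symm.norm_le
  obtain ⟨B, hB⟩ := cauchySeq_tendsto_of_complete hcauchy
  have happ {w : ℕ → Z →L[ℂ] Z} {T : Z →L[ℂ] Z} (h : Filter.Tendsto w Filter.atTop (nhds T))
      (y : Z) : Filter.Tendsto (fun n ↦ w n y) Filter.atTop (nhds (T y)) :=
    ((ContinuousLinearMap.apply ℂ Z y).continuous.tendsto T).comp h
  refine ⟨B, fun x y z ↦ ?_, fun x y z ↦ ?_⟩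
  · refine tendsto_nhds_unique
      (((S.continuous_t_mid x z).tendsto _).comp (happ hlim y)) ?_
    refine (((S.continuous_t_right x y).tendsto _).comp (happ hB z)).congr fun n ↦ ?_
    exact ((hv n).1 x y z).symm
  · refine tendsto_nhds_unique
      (((S.continuous_t_mid x z).tendsto _).comp (happ hB y)) ?_
    refine (((S.continuous_t_right x y).tendsto _).comp (happ hlim z)).congr fun n ↦ ?_
    exact ((hv n).2 x y z).symm

section CStarAlgebra

variable {S : CstarTernary Z}

noncomputable instance : Star S.adjointable :=
  ⟨fun A ↦ ⟨A.2.choose, A.1, A.2.choose_spec.symm⟩⟩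

theorem isAdjoint_star (A : S.adjointable) :
    S.IsAdjoint (A : Z →L[ℂ] Z) (star A : S.adjointable) :=
  A.2.choose_spec

theorem star_eq_of_isAdjoint {A B : S.adjointable}
    (h : S.IsAdjoint (A : Z →L[ℂ] Z) (B : Z →L[ℂ] Z)) : star A = B :=
  Subtype.ext ((isAdjoint_star A).unique h)

noncomputable instance : StarRing S.adjointable where
  star_involutive A := star_eq_of_isAdjoint (isAdjoint_star A).symm
  star_mul A B := star_eq_of_isAdjoint ((isAdjoint_star A).mul (isAdjoint_star B))
  star_add A B := star_eq_of_isAdjoint ((isAdjoint_star A).add (isAdjoint_star B))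

noncomputable instance [CompleteSpace Z] : CStarAlgebra S.adjointable where
  toCompleteSpace := S.isClosed_adjointable.completeSpace_coe
  norm_mul_self_le A := (isAdjoint_star A).norm_mul_self_le
  star_smul c A := star_eq_of_isAdjoint ((isAdjoint_star A).smul c)

noncomputable instance [CompleteSpace Z] : PartialOrder S.adjointable :=
  CStarAlgebra.spectralOrder _

instance [CompleteSpace Z] : StarOrderedRing S.adjointable :=
  CStarAlgebra.spectralOrderedRing _

end CStarAlgebra

section LeftMul

variable (S : CstarTernary Z)

/-- The operator `z ↦ [x y z]` as a continuous linear map. -/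
noncomputable def leftMulCLM (x y : Z) : Z →L[ℂ] Z :=
  LinearMap.mkContinuous
    { toFun := S.t x y
      map_add' := S.add_right x y
      map_smul' := fun c z ↦ S.smul_right c x y z } (‖x‖ * ‖y‖) (S.norm_le x y)

@[simp]
theorem leftMulCLM_apply (x y z : Z) : S.leftMulCLM x y z = S.t x y z := rfl

theorem isAdjoint_leftMulCLM (x y : Z) : S.IsAdjoint (S.leftMulCLM x y) (S.leftMulCLM y x) :=
  ⟨fun a b c ↦ by rw [leftMulCLM_apply, leftMulCLM_apply, ← S.assoc₁, S.assoc₂],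
    fun a b c ↦ by rw [leftMulCLM_apply, leftMulCLM_apply, ← S.assoc₁, S.assoc₂]⟩

/-- The operator `z ↦ [x y z]` as an adjointable operator. -/
noncomputable def leftMul (x y : Z) : S.adjointable :=
  ⟨S.leftMulCLM x y, _, S.isAdjoint_leftMulCLM x y⟩

@[simp]
theorem leftMul_apply (x y z : Z) : (S.leftMul x y : Z →L[ℂ] Z) z = S.t x y z := rfl

variable {S} in
theorem adjointable_ext {A B : S.adjointable}
    (h : ∀ z, (A : Z →L[ℂ] Z) z = (B : Z →L[ℂ] Z) z) : A = B :=
  Subtype.ext (ContinuousLinearMap.ext h)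

@[simp]
theorem star_leftMul (x y : Z) : star (S.leftMul x y) = S.leftMul y x :=
  star_eq_of_isAdjoint (S.isAdjoint_leftMulCLM x y)

theorem isSelfAdjoint_smul_leftMul (e : ℝ) (x : Z) :
    IsSelfAdjoint ((e : ℂ) • S.leftMul x x) :=
  star_eq_of_isAdjoint (by
    have := (S.isAdjoint_leftMulCLM x x).smul (e : ℂ)
    rwa [Complex.conj_ofReal] at this)

theorem eq_zero_of_leftMul_self_eq_zero {x : Z} (h : S.leftMul x x = 0) : x = 0 := by
  refine S.eq_zero_of_cube_eq_zero ?_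
  rw [← leftMul_apply, h]
  rfl

/-- `D([x x y], [x x y]) = D(x,x) D(y,y) D(x,x)` for the left multiplications `D`. -/
theorem leftMul_conj (x y : Z) :
    S.leftMul (S.t x x y) (S.t x x y) = S.leftMul x x * S.leftMul y y * star (S.leftMul x x) := by
  rw [star_leftMul]
  refine adjointable_ext fun z ↦ ?_
  change S.t (S.t x x y) (S.t x x y) z = S.t x x (S.t y y (S.t x x z))
  rw [S.assoc₂, ← S.assoc₁ y y x, S.assoc₂ y y]

/-- The right multiplication by `([x x y], [x x y])` is a conjugate of that by `(x, x)`. -/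
theorem leftMul_flip_conj (x y : Z) :
    S.flip.leftMul (S.t x x y) (S.t x x y) =
      S.flip.leftMul y x * S.flip.leftMul x x * star (S.flip.leftMul y x) := by
  rw [star_leftMul]
  refine adjointable_ext fun z ↦ ?_
  change S.t z (S.t x x y) (S.t x x y) = S.t (S.t (S.t z y x) x x) x y
  rw [← S.assoc₁, S.assoc₂ z y x, S.assoc₂ z y]
  simp only [S.assoc₂]

end LeftMul

section Positivity

variable [CompleteSpace Z] (S : CstarTernary Z)

/-- If `e [x x w] + l w = x` is solvable in `w` for all `l > 0`, then `e D(x,x)` is positive. -/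
theorem smul_leftMul_nonneg_of_resolvent (e : ℝ) (x : Z)
    (h : ∀ l : ℝ, 0 < l → ∃ w, (e : ℂ) • S.t x x w + (l : ℂ) • w = x) :
    0 ≤ (e : ℂ) • S.leftMul x x := by
  refine nonneg_of_forall_add_mul_eq (S.isSelfAdjoint_smul_leftMul e x) fun l hl ↦ ?_
  obtain ⟨w, hw⟩ := h l hl
  refine ⟨1 - (e : ℂ) • S.leftMul w x, adjointable_ext fun z ↦ ?_⟩
  have hz : (e : ℂ) • S.t x x (S.t w x z) + (l : ℂ) • S.t w x z = S.t x x z := by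
    rw [← S.assoc₂, ← S.smul_left _ (S.t x x w), ← S.smul_left _ w, ← S.add_left, hw]
  change (l : ℂ) • (z - (e : ℂ) • S.t w x z)
    + (e : ℂ) • S.t x x (z - (e : ℂ) • S.t w x z) = (l : ℂ) • z
  rw [S.t_sub_right, S.smul_right, ← hz]
  module

/-- Positivity of left multiplication by `(x, x)` gives solvability of `e [x x w] + l w = x`. -/
theorem resolvent_of_smul_leftMul_nonneg {e : ℝ} {x : Z}
    (h : 0 ≤ (e : ℂ) • S.leftMul x x) {l : ℝ} (hl : 0 < l) :
    ∃ w, (e : ℂ) • S.t x x w + (l : ℂ) • w = x := by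
  obtain ⟨u, hu⟩ := isUnit_smul_one_add_of_nonneg h hl
  refine ⟨((↑u⁻¹ : S.adjointable) : Z →L[ℂ] Z) x, ?_⟩
  have := congrArg (fun A : S.adjointable ↦ (A : Z →L[ℂ] Z) x) u.mul_inv
  rw [hu] at this
  rw [add_comm]
  exact this

/-- Positivity of right multiplication by `(x, x)` implies that of left multiplication. -/
theorem smul_leftMul_nonneg_of_flip {e : ℝ} {x : Z}
    (h : 0 ≤ (e : ℂ) • S.flip.leftMul x x) : 0 ≤ (e : ℂ) • S.leftMul x x := by
  refine S.smul_leftMul_nonneg_of_resolvent e x fun l hl ↦ ?_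
  obtain ⟨w, hw⟩ := S.flip.resolvent_of_smul_leftMul_nonneg h hl
  simp only [flip_t] at hw
  refine ⟨w, ?_⟩
  obtain ⟨u, hu⟩ := isUnit_smul_one_add_of_nonneg h hl
  have hinj (v : Z) (hv : (e : ℂ) • S.t v x x + (l : ℂ) • v = 0) : v = 0 := by
    have h1 := congrArg (fun A : S.flip.adjointable ↦ (A : Z →L[ℂ] Z) v) u.inv_mul
    have h2 : (((u : S.flip.adjointable)) : Z →L[ℂ] Z) v = 0 := by
      rw [hu, ← hv, add_comm]
      rfl
    have h3 : ((↑u⁻¹ : S.flip.adjointable) : Z →L[ℂ] Z)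
        (((u : S.flip.adjointable) : Z →L[ℂ] Z) v) = v := h1
    rw [← h3, h2, map_zero]
  have hcomm : S.t x x w - S.t w x x = 0 := by
    apply hinj
    have h1 : S.t (S.t x x w - S.t w x x) x x
        = S.t x x (S.t w x x) - S.t (S.t w x x) x x := by
      have := S.flip.t_sub_right x x (S.t x x w) (S.t w x x)
      simp only [flip_t] at this
      rw [this, S.assoc₂]
    have h2 : S.t x x ((e : ℂ) • S.t w x x + (l : ℂ) • w) = S.t x x x := by rw [hw]
    have h3 : S.t ((e : ℂ) • S.t w x x + (l : ℂ) • w) x x = S.t x x x := by rw [hw]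
    rw [S.add_right, S.smul_right, S.smul_right] at h2
    rw [S.add_left, S.smul_left, S.smul_left] at h3
    rw [h1]
    linear_combination (norm := module) h2 - h3
  rw [sub_eq_zero.1 hcomm]
  exact hw

end Positivity

end CstarTernary

section ZettlPart

variable {Z : Type*} [NormedAddCommGroup Z] [NormedSpace ℂ Z]

theorem norm_smul_sub_comp_adjoint_le {H K : Type*}
    [NormedAddCommGroup H] [InnerProductSpace ℂ H] [CompleteSpace H]
    [NormedAddCommGroup K] [InnerProductSpace ℂ K] [CompleteSpace K] (X : H →L[ℂ] K) :
    ‖((‖X‖ ^ 2 : ℝ) : ℂ) • (1 : K →L[ℂ] K) - X.comp (ContinuousLinearMap.adjoint X)‖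
      ≤ ‖X‖ ^ 2 := by
  refine ContinuousLinearMap.opNorm_le_bound _ (by positivity) fun k ↦ ?_
  set Y := ContinuousLinearMap.adjoint X with hY
  refine le_of_sq_le_sq ?_ (by positivity)
  change ‖((‖X‖ ^ 2 : ℝ) : ℂ) • k - X (Y k)‖ ^ 2 ≤ _
  rw [@norm_sub_sq ℂ, norm_smul, inner_smul_left, ← ContinuousLinearMap.adjoint_inner_left,
    inner_self_eq_norm_sq_to_K, Complex.conj_ofReal, Complex.norm_real,
    Real.norm_of_nonneg (by positivity)]
  have h1 : RCLike.re (((‖X‖ ^ 2 : ℝ) : ℂ) * ((‖Y k‖ : ℝ) : ℂ) ^ 2) = ‖X‖ ^ 2 * ‖Y k‖ ^ 2 := by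
    norm_cast
  have h2 : ‖X (Y k)‖ ^ 2 ≤ ‖X‖ ^ 2 * ‖Y k‖ ^ 2 := by
    rw [← mul_pow]
    gcongr
    exact X.le_opNorm _
  have h3 : 0 ≤ ‖X‖ ^ 2 * ‖Y k‖ ^ 2 := by positivity
  erw [h1]
  linarith

theorem IsZettlPart.norm_smul_sub_le {S : CstarTernary Z} {P : Submodule ℂ Z} {e : ℝ}
    (h : IsZettlPart S P e) (he : e * e = 1) {x z : Z} (hx : x ∈ P) (hz : z ∈ P) :
    ‖((‖x‖ ^ 2 : ℝ) : ℂ) • z - (e : ℂ) • S.t x x z‖ ≤ ‖x‖ ^ 2 * ‖z‖ := by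
  obtain ⟨-, hmem, H, K, _, _, _, _, _, _, ψ, hnorm, hprod⟩ := h
  let x' : P := ⟨x, hx⟩
  let z' : P := ⟨z, hz⟩
  let w' : P := ⟨S.t x x z, hmem x x z hx hx hz⟩
  have hw := hprod x' x' z' w' rfl
  have h1 := hnorm (((‖x‖ ^ 2 : ℝ) : ℂ) • z' - (e : ℂ) • w')
  have h2 : ψ (((‖x‖ ^ 2 : ℝ) : ℂ) • z' - (e : ℂ) • w') =
      (((‖ψ x'‖ ^ 2 : ℝ) : ℂ) • (1 : K →L[ℂ] K)
        - (ψ x').comp (ContinuousLinearMap.adjoint (ψ x'))).comp (ψ z') := by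
    rw [map_sub, map_smul, map_smul, hw, hnorm x', Complex.coe_smul e, smul_smul, he, one_smul]
    rfl
  change ‖_‖ = ‖((‖x‖ ^ 2 : ℝ) : ℂ) • z - (e : ℂ) • S.t x x z‖ at h1
  rw [← h1, h2]
  refine (ContinuousLinearMap.opNorm_comp_le _ _).trans ?_
  rw [hnorm z']
  gcongr
  refine (norm_smul_sub_comp_adjoint_le (ψ x')).trans_eq ?_
  rw [hnorm x']

theorem IsZettlPart.resolvent [CompleteSpace Z] {S : CstarTernary Z} {P : Submodule ℂ Z} {e : ℝ}
    (h : IsZettlPart S P e) (he : e * e = 1) {x : Z} (hx : x ∈ P) {l : ℝ} (hl : 0 < l) :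
    ∃ w, (e : ℂ) • S.t x x w + (l : ℂ) • w = x := by
  set m : ℝ := ‖x‖ ^ 2 with hm
  have hm0 : 0 ≤ m := by positivity
  have hlm : ((l + m : ℝ) : ℂ) ≠ 0 := by
    exact_mod_cast (by positivity : (l + m : ℝ) ≠ 0)
  have : CompleteSpace P := h.1.completeSpace_coe
  let f : P → P := fun z ↦ ⟨((l + m : ℝ) : ℂ)⁻¹ • (x + ((m : ℂ) • (z : Z) - (e : ℂ) • S.t x x z)),
    P.smul_mem _ (P.add_mem hx (P.sub_mem (P.smul_mem _ z.2)
      (P.smul_mem _ (h.2.1 x x z hx hx z.2))))⟩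
  obtain ⟨K, hK⟩ : ∃ K : NNReal, (K : ℝ) = m / (l + m) := ⟨⟨_, by positivity⟩, rfl⟩
  have hf : ContractingWith K f := by
    refine ⟨?_, LipschitzWith.of_dist_le_mul fun z w ↦ ?_⟩
    · rw [← NNReal.coe_lt_coe, hK, NNReal.coe_one, div_lt_one (by positivity)]
      linarith
    · rw [dist_eq_norm, dist_eq_norm, hK]
      change ‖((l + m : ℝ) : ℂ)⁻¹ • (x + ((m : ℂ) • (z : Z) - (e : ℂ) • S.t x x z))
        - ((l + m : ℝ) : ℂ)⁻¹ • (x + ((m : ℂ) • (w : Z) - (e : ℂ) • S.t x x w))‖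
        ≤ m / (l + m) * ‖(z : Z) - w‖
      have heq : ((l + m : ℝ) : ℂ)⁻¹ • (x + ((m : ℂ) • (z : Z) - (e : ℂ) • S.t x x z))
          - ((l + m : ℝ) : ℂ)⁻¹ • (x + ((m : ℂ) • (w : Z) - (e : ℂ) • S.t x x w))
          = ((l + m : ℝ) : ℂ)⁻¹ •
            ((m : ℂ) • ((z : Z) - w) - (e : ℂ) • S.t x x ((z : Z) - w)) := by
        rw [S.t_sub_right]
        module
      rw [heq, norm_smul, norm_inv, Complex.norm_real, Real.norm_of_nonneg (by positivity)]
      have := h.norm_smul_sub_le he hx (P.sub_mem z.2 w.2)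
      calc (l + m)⁻¹ * _ ≤ (l + m)⁻¹ * (m * ‖(z : Z) - w‖) := by gcongr
        _ = _ := by ring
  have hfix := congrArg Subtype.val hf.fixedPoint_isFixedPt
  set w : Z := ((hf.fixedPoint f : P) : Z)
  change ((l + m : ℝ) : ℂ)⁻¹ • (x + ((m : ℂ) • w - (e : ℂ) • S.t x x w)) = w at hfix
  rw [inv_smul_eq_iff₀ hlm, Complex.ofReal_add] at hfix
  refine ⟨w, ?_⟩
  linear_combination (norm := module) -hfix

theorem IsZettlPart.smul_leftMul_nonneg [CompleteSpace Z] {S : CstarTernary Z}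
    {P : Submodule ℂ Z} {e : ℝ} (h : IsZettlPart S P e) (he : e * e = 1) {x : Z} (hx : x ∈ P) :
    0 ≤ (e : ℂ) • S.leftMul x x :=
  S.smul_leftMul_nonneg_of_resolvent e x fun _ hl ↦ h.resolvent he hx hl

namespace CstarTernary

variable [CompleteSpace Z] (S : CstarTernary Z)

theorem smul_leftMul_conj_nonneg {e : ℝ} (x : Z) {y : Z} (h : 0 ≤ (e : ℂ) • S.leftMul y y) :
    0 ≤ (e : ℂ) • S.leftMul (S.t x x y) (S.t x x y) := by
  rw [S.leftMul_conj, ← smul_mul_assoc, ← mul_smul_comm]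
  exact star_right_conjugate_nonneg h _

theorem eq_zero_of_smul_leftMul_nonneg {e : ℝ} (he : e * e = 1) {x : Z}
    (h : 0 ≤ (e : ℂ) • S.leftMul x x) (h' : 0 ≤ ((-e : ℝ) : ℂ) • S.leftMul x x) : x = 0 := by
  rw [Complex.ofReal_neg, neg_smul, neg_nonneg] at h'
  refine S.eq_zero_of_leftMul_self_eq_zero ?_
  refine (smul_eq_zero.1 (le_antisymm h' h)).resolve_left fun h0 ↦ ?_
  rw [Complex.ofReal_eq_zero] at h0
  simp [h0] at he

/-- Elements of opposite sign are orthogonal. -/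
theorem t_eq_zero_of_opposite {e : ℝ} (he : e * e = 1) {p q : Z}
    (hp : 0 ≤ (e : ℂ) • S.leftMul p p) (hq : 0 ≤ ((-e : ℝ) : ℂ) • S.leftMul q q) :
    S.t q q p = 0 := by
  refine S.eq_zero_of_smul_leftMul_nonneg he (S.smul_leftMul_conj_nonneg q hp) ?_
  refine S.smul_leftMul_nonneg_of_flip ?_
  have hq' : 0 ≤ ((-e : ℝ) : ℂ) • S.flip.leftMul q q := S.flip.smul_leftMul_nonneg_of_flip hq
  rw [S.leftMul_flip_conj, ← smul_mul_assoc, ← mul_smul_comm]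
  exact star_right_conjugate_nonneg hq' _

theorem right_eq_zero_of_add_nonneg {e : ℝ} (he : e * e = 1) {p q : Z}
    (hp : 0 ≤ (e : ℂ) • S.leftMul p p) (hq : 0 ≤ ((-e : ℝ) : ℂ) • S.leftMul q q)
    (h : 0 ≤ (e : ℂ) • S.leftMul (p + q) (p + q)) : q = 0 := by
  refine S.eq_zero_of_cube_eq_zero ?_
  have hsum : S.t q q (p + q) = S.t q q q := by
    rw [S.add_right, S.t_eq_zero_of_opposite he hp hq, zero_add]
  refine S.eq_zero_of_smul_leftMul_nonneg he ?_ (S.smul_leftMul_conj_nonneg q hq)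
  rw [← hsum]
  exact S.smul_leftMul_conj_nonneg q h

theorem smul_leftMul_map_nonneg {W : Type*} [NormedAddCommGroup W] [NormedSpace ℂ W]
    [CompleteSpace W] {S : CstarTernary Z} {T : CstarTernary W} (φ : Z →ₗ[ℂ] W)
    (hhom : ∀ x y z, φ (S.t x y z) = T.t (φ x) (φ y) (φ z)) {e : ℝ} {x : Z}
    (h : 0 ≤ (e : ℂ) • S.leftMul x x) : 0 ≤ (e : ℂ) • T.leftMul (φ x) (φ x) := by
  refine T.smul_leftMul_nonneg_of_resolvent e (φ x) fun l hl ↦ ?_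
  obtain ⟨w, hw⟩ := S.resolvent_of_smul_leftMul_nonneg h hl
  refine ⟨φ w, ?_⟩
  rw [← hhom, ← map_smul, ← map_smul, ← map_add, hw]

end CstarTernary

theorem IsZettlPart.map_mem {W : Type*} [NormedAddCommGroup W] [NormedSpace ℂ W]
    [CompleteSpace Z] [CompleteSpace W] {S : CstarTernary Z} {T : CstarTernary W}
    {P : Submodule ℂ Z} {Q R : Submodule ℂ W} {e : ℝ} (he : e * e = 1)
    (hP : IsZettlPart S P e) (hQ : IsZettlPart T Q e) (hR : IsZettlPart T R (-e))
    (hsum : Q ⊔ R = ⊤) (φ : Z →ₗ[ℂ] W)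
    (hhom : ∀ x y z, φ (S.t x y z) = T.t (φ x) (φ y) (φ z)) {x : Z} (hx : x ∈ P) :
    φ x ∈ Q := by
  obtain ⟨q, hq, r, hr, hqr⟩ := Submodule.mem_sup.1 (hsum ▸ Submodule.mem_top : φ x ∈ Q ⊔ R)
  have hpos := CstarTernary.smul_leftMul_map_nonneg φ hhom (hP.smul_leftMul_nonneg he hx)
  rw [← hqr] at hpos
  have hr0 : r = 0 := T.right_eq_zero_of_add_nonneg he (hQ.smul_leftMul_nonneg he hq)
    (hR.smul_leftMul_nonneg (by linarith) hr) hpos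
  rw [← hqr, hr0, add_zero]
  exact hq

end ZettlPart

theorem Submodule.map_eq_of_disjoint_of_surjective {V W : Type*} [AddCommGroup V] [Module ℂ V]
    [AddCommGroup W] [Module ℂ W] {P P' : Submodule ℂ V} {Q Q' : Submodule ℂ W}
    {φ : V →ₗ[ℂ] W} (hφ : Function.Surjective φ) (hsum : P ⊔ P' = ⊤) (hdisj : Q ⊓ Q' = ⊥)
    (h : ∀ x ∈ P, φ x ∈ Q) (h' : ∀ x ∈ P', φ x ∈ Q') : Submodule.map φ P = Q := by
  refine le_antisymm (Submodule.map_le_iff_le_comap.2 h) fun y hy ↦ ?_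
  obtain ⟨x, rfl⟩ := hφ y
  obtain ⟨p, hp, p', hp', rfl⟩ :=
    Submodule.mem_sup.1 (hsum ▸ Submodule.mem_top : x ∈ P ⊔ P')
  have hmem : φ p' ∈ Q ⊓ Q' := by
    refine ⟨?_, h' p' hp'⟩
    have := Q.sub_mem hy (h p hp)
    rwa [map_add, add_sub_cancel_left] at this
  rw [hdisj, Submodule.mem_bot] at hmem
  exact ⟨p, hp, by rw [map_add, hmem, add_zero]⟩

/-- Let `M` and `N` be C*-ternary rings with Zettl decompositions `M = Mp ⊕ Mm`,
`N = Np ⊕ Nm`, where the positive parts are isometrically isomorphic to TROs and the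
negative parts are isometrically anti-isomorphic to TROs.  If `φ : M → N` is a surjective
homomorphism of C*-ternary rings, then `φ(Mp) = Np` and `φ(Mm) = Nm`. -/
theorem cstarTernary_surjective_hom_preserves_zettl_parts
    {M : Type*} [NormedAddCommGroup M] [NormedSpace ℂ M] [CompleteSpace M]
    {N : Type*} [NormedAddCommGroup N] [NormedSpace ℂ N] [CompleteSpace N]
    (SM : CstarTernary M) (SN : CstarTernary N)
    (Mp Mm : Submodule ℂ M) (Np Nm : Submodule ℂ N)
    (hMp : IsZettlPart SM Mp 1) (hMm : IsZettlPart SM Mm (-1))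
    (hMdisj : Mp ⊓ Mm = ⊥) (hMsum : Mp ⊔ Mm = ⊤)
    (hNp : IsZettlPart SN Np 1) (hNm : IsZettlPart SN Nm (-1))
    (hNdisj : Np ⊓ Nm = ⊥) (hNsum : Np ⊔ Nm = ⊤)
    (φ : M →ₗ[ℂ] N) (hsurj : Function.Surjective φ)
    (hhom : ∀ x y z : M, φ (SM.t x y z) = SN.t (φ x) (φ y) (φ z)) :
    Submodule.map φ Mp = Np ∧ Submodule.map φ Mm = Nm := by
  have hp (x : M) (hx : x ∈ Mp) : φ x ∈ Np :=
    hMp.map_mem (by norm_num) hNp hNm hNsum φ hhom hx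
  have hm (x : M) (hx : x ∈ Mm) : φ x ∈ Nm :=
    hMm.map_mem (by norm_num) hNm (by rwa [neg_neg]) (by rwa [sup_comm]) φ hhom hx
  exact ⟨Submodule.map_eq_of_disjoint_of_surjective hsurj hMsum hNdisj hp hm,
    Submodule.map_eq_of_disjoint_of_surjective hsurj (by rwa [sup_comm])
      (by rwa [inf_comm]) hm hp⟩
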